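/- arXiv:2306.00524 — 2 statements merged into one kernel-verified Lean document; each statement's English description precedes it below -/
import Mathlib

section
/- Let f be a homeomorphism of a compact metric space X, let λ>1, and let D':E→ℝ be a hyperbolic cw-metric for f with 0≤D'(C_(p,q))≤1 for all C_(p,q)∈E. Define D:E→ℝ by D(C_(p,q)) = sup_{i∈ℤ} D'(f^i(C_(p,q)))/λ^{|i|}. Then for every ε>0 there exists ξ>0 such that D'(C_(p,q))≤ξ implies D(C_(p,q))≤ε. Consequently, D is compatible with the diameter: for every δ>0 there is γ>0 such that diam(C)<γ implies D(C_(p,q))<δ for all p,q∈C, and D(C_(p,q))<γ for some p,q∈C implies diam(C)<δ. -/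
open Metric Set Filter Topology

namespace CwDyn

variable {X : Type*} [MetricSpace X]

/-- The ε-stable set of `x`. -/
def Ws (f : X ≃ₜ X) (ε : ℝ) (x : X) : Set X :=
  {y | ∀ n : ℕ, dist ((⇑f)^[n] x) ((⇑f)^[n] y) ≤ ε}

/-- The ε-unstable set of `x`. -/
def Wu (f : X ≃ₜ X) (ε : ℝ) (x : X) : Set X :=
  {y | ∀ n : ℕ, dist ((⇑f.symm)^[n] x) ((⇑f.symm)^[n] y) ≤ ε}

/-- The connected component of `x` in its ε-stable set. -/
def Cs (f : X ≃ₜ X) (ε : ℝ) (x : X) : Set X := connectedComponentIn (Ws f ε x) x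

/-- The connected component of `x` in its ε-unstable set. -/
def Cu (f : X ≃ₜ X) (ε : ℝ) (x : X) : Set X := connectedComponentIn (Wu f ε x) x

/-- `c` is a cw-expansive constant for `f`. -/
def CwExpansiveConst (f : X ≃ₜ X) (c : ℝ) : Prop :=
  0 < c ∧ ∀ x : X, IsTotallyDisconnected (Ws f c x ∩ Wu f c x)

/-- The cw-local-product-structure. -/
def CwLocalProduct (f : X ≃ₜ X) : Prop :=
  ∀ ε : ℝ, 0 < ε → ∃ δ : ℝ, 0 < δ ∧
    ∀ x y : X, dist x y < δ → (Cs f ε x ∩ Cu f ε y).Nonempty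

/-- `f` is cw-hyperbolic: cw-expansive with the cw-local-product-structure. -/
def CwHyperbolic (f : X ≃ₜ X) : Prop :=
  (∃ c : ℝ, CwExpansiveConst f c) ∧ CwLocalProduct f

/-- A subcontinuum: a nonempty compact connected subset. -/
def Subcontinuum (C : Set X) : Prop := IsCompact C ∧ IsConnected C

/-- `D` is a hyperbolic cw-metric for `f`, viewed as a function of triples `(p, q, C)`
with `C` a subcontinuum and `p, q ∈ C`. -/
structure IsHypCwMetric (f : X ≃ₜ X) (D : X → X → Set X → ℝ) : Prop where
  nonneg : ∀ (C : Set X) (p q : X), Subcontinuum C → p ∈ C → q ∈ C → 0 ≤ D p q C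
  eq_zero_iff : ∀ (C : Set X) (p q : X), Subcontinuum C → p ∈ C → q ∈ C →
    (D p q C = 0 ↔ ∃ z : X, C = {z})
  symm : ∀ (C : Set X) (p q : X), Subcontinuum C → p ∈ C → q ∈ C → D p q C = D q p C
  triangle : ∀ (A B : Set X) (a b c : X), Subcontinuum A → Subcontinuum B →
    a ∈ A → b ∈ A → b ∈ B → c ∈ B → D a c (A ∪ B) ≤ D a b A + D b c B
  hyperbolic : ∃ lam : ℝ, lam ∈ Set.Ioo (0 : ℝ) 1 ∧ ∃ ε₀ : ℝ, 0 < ε₀ ∧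
    (∀ (C : Set X) (p q : X), Subcontinuum C → p ∈ C → q ∈ C →
      (∀ n : ℕ, diam ((⇑f)^[n] '' C) ≤ ε₀) →
      ∀ n : ℕ, D ((⇑f)^[n] p) ((⇑f)^[n] q) ((⇑f)^[n] '' C) ≤ 4 * lam ^ n * D p q C) ∧
    (∀ (C : Set X) (p q : X), Subcontinuum C → p ∈ C → q ∈ C →
      (∀ n : ℕ, diam ((⇑f.symm)^[n] '' C) ≤ ε₀) →
      ∀ n : ℕ, D ((⇑f.symm)^[n] p) ((⇑f.symm)^[n] q) ((⇑f.symm)^[n] '' C) ≤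
        4 * lam ^ n * D p q C)
  compat : ∀ δ : ℝ, 0 < δ → ∃ γ : ℝ, 0 < γ ∧
    (∀ (C : Set X) (p q : X), Subcontinuum C → p ∈ C → q ∈ C → diam C < γ → D p q C < δ) ∧
    (∀ (C : Set X) (p q : X), Subcontinuum C → p ∈ C → q ∈ C → D p q C < γ → diam C < δ)

/-- A hyperbolic cw-metric `D` is self-similar with constants `ξ` and `lam`. -/
def SelfSimilarWith (f : X ≃ₜ X) (D : X → X → Set X → ℝ) (ξ lam : ℝ) : Prop :=
  ∀ (C : Set X) (p q : X), Subcontinuum C → p ∈ C → q ∈ C → D p q C ≤ ξ →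
    max (D (f p) (f q) (⇑f '' C)) (D (f.symm p) (f.symm q) (⇑f.symm '' C)) = lam * D p q C

/-- `f` has continuous joint stable/unstable holonomies with respect to `D`
(for the fixed constants `ε` and `δ`); the membership `pstar ∈ Cu f ε p ∩ Cs f ε y`
says exactly that `pstar ∈ π^s_{x,y}(p)`. -/
def ContJointHolonomies (f : X ≃ₜ X) (D : X → X → Set X → ℝ) (ε δ : ℝ) : Prop :=
  ∀ η : ℝ, 0 < η → ∃ γ : ℝ, 0 < γ ∧
    ∀ (x y p q pstar : X) (C C' : Set X),
      dist x y < δ →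
      Subcontinuum C → C ⊆ Cs f ε x → p ∈ C → q ∈ C → D p q C ≤ γ →
      pstar ∈ Cu f ε p ∩ Cs f ε y →
      Subcontinuum C' → C' ⊆ Cu f ε p → p ∈ C' → pstar ∈ C' → D p pstar C' ≤ γ →
      ∃ (Cst Cuu : Set X) (qstar : X),
        Subcontinuum Cst ∧ Cst ⊆ Cs f ε y ∧ pstar ∈ Cst ∧
        Subcontinuum Cuu ∧ Cuu ⊆ Cu f ε q ∧ q ∈ Cuu ∧
        qstar ∈ Cst ∩ Cuu ∧
        D pstar qstar Cst ≤ η ∧ D q qstar Cuu ≤ η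

/-- `f` has pseudo-isometric joint stable/unstable holonomies with respect to `D`. -/
def PseudoIsomJointHolonomies (f : X ≃ₜ X) (D : X → X → Set X → ℝ) (ε δ : ℝ) : Prop :=
  ∀ η : ℝ, 0 < η → ∃ γ : ℝ, 0 < γ ∧
    ∀ (x y p q pstar : X) (C C' : Set X),
      dist x y < δ →
      Subcontinuum C → C ⊆ Cs f ε x → p ∈ C → q ∈ C → D p q C ≤ γ →
      pstar ∈ Cu f ε p ∩ Cs f ε y →
      Subcontinuum C' → C' ⊆ Cu f ε p → p ∈ C' → pstar ∈ C' → D p pstar C' ≤ γ →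
      ∃ (Cst Cuu : Set X) (qstar : X),
        Subcontinuum Cst ∧ Cst ⊆ Cs f ε y ∧ pstar ∈ Cst ∧
        Subcontinuum Cuu ∧ Cuu ⊆ Cu f ε q ∧ q ∈ Cuu ∧
        qstar ∈ Cst ∩ Cuu ∧
        |D pstar qstar Cst / D p q C - 1| ≤ η ∧ |D q qstar Cuu / D p pstar C' - 1| ≤ η

/-- All local stable holonomies of `f` are isometric with respect to `D`. -/
def IsomStableHolonomies (f : X ≃ₜ X) (D : X → X → Set X → ℝ) (ε δ : ℝ) : Prop :=
  ∀ x y : X, dist x y < δ →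
    ∀ (C : Set X) (p q : X), Subcontinuum C → C ⊆ Cs f δ x → p ∈ C → q ∈ C →
      ∃ (Cst : Set X) (pstar qstar : X),
        Subcontinuum Cst ∧ Cst ⊆ Cs f ε y ∧
        pstar ∈ Cu f ε p ∩ Cs f ε y ∧ pstar ∈ Cst ∧
        qstar ∈ Cu f ε q ∩ Cs f ε y ∧ qstar ∈ Cst ∧
        D pstar qstar Cst = D p q C

/-- All local unstable holonomies of `f` are isometric with respect to `D`. -/
def IsomUnstableHolonomies (f : X ≃ₜ X) (D : X → X → Set X → ℝ) (ε δ : ℝ) : Prop :=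
  ∀ x y : X, dist x y < δ →
    ∀ (C : Set X) (p q : X), Subcontinuum C → C ⊆ Cu f δ x → p ∈ C → q ∈ C →
      ∃ (Cst : Set X) (pstar qstar : X),
        Subcontinuum Cst ∧ Cst ⊆ Cu f ε y ∧
        pstar ∈ Cs f ε p ∩ Cu f ε y ∧ pstar ∈ Cst ∧
        qstar ∈ Cs f ε q ∩ Cu f ε y ∧ qstar ∈ Cst ∧
        D pstar qstar Cst = D p q C

/-- The set of periodic points of `g`. -/
def Per (g : X → X) : Set X := {x | ∃ k : ℕ, 1 ≤ k ∧ g^[k] x = x}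

/-- The set of non-wandering points of `g`. -/
def Omega (g : X → X) : Set X :=
  {x | ∀ U ∈ 𝓝 x, ∃ k : ℕ, 1 ≤ k ∧ (g^[k] '' U ∩ U).Nonempty}

/-- Topological transitivity. -/
def TopTransitive (g : X → X) : Prop :=
  ∀ U V : Set X, IsOpen U → IsOpen V → U.Nonempty → V.Nonempty →
    ∃ n : ℕ, (g^[n] '' U ∩ V).Nonempty

/-- There is a finite ε-pseudo-orbit from `x` to `y` (of length at least one). -/
def PseudoOrbit (g : X → X) (ε : ℝ) (x y : X) : Prop :=
  ∃ (m : ℕ) (σ : ℕ → X), 1 ≤ m ∧ σ 0 = x ∧ σ m = y ∧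
    ∀ k < m, dist (g (σ k)) (σ (k + 1)) ≤ ε

/-- `x` is a chain recurrent point of `g`. -/
def ChainRecurrent (g : X → X) (x : X) : Prop := ∀ ε : ℝ, 0 < ε → PseudoOrbit g ε x x

/-- The chain-recurrent class of `x`. -/
def ChainClass (g : X → X) (x : X) : Set X :=
  {y | ChainRecurrent g y ∧ ∀ ε : ℝ, 0 < ε → PseudoOrbit g ε x y ∧ PseudoOrbit g ε y x}

/-- `C` is a chain-recurrent class of `g`. -/
def IsChainClass (g : X → X) (C : Set X) : Prop :=
  ∃ x : X, ChainRecurrent g x ∧ C = ChainClass g x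

/-- The stable set of a set `C`: points whose forward orbit converges to `C`. -/
def Wstab (g : X → X) (C : Set X) : Set X :=
  {x | Tendsto (fun k : ℕ => infDist (g^[k] x) C) atTop (𝓝 0)}

/-- The unstable set of a set `C`: points whose backward orbit converges to `C`. -/
def Wunstab (f : X ≃ₜ X) (C : Set X) : Set X :=
  {x | Tendsto (fun k : ℕ => infDist ((⇑f.symm)^[k] x) C) atTop (𝓝 0)}

/-- The `n`-th iterate of a homeomorphism, for `n : ℤ`. -/
def zIter (f : X ≃ₜ X) (n : ℤ) : X → X :=
  if 0 ≤ n then (⇑f)^[n.toNat] else (⇑f.symm)^[(-n).toNat]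

/-- Kato's property for the constant `m`: any subcontinuum of diameter greater than `c/2`
attains diameter greater than `c` within `m` iterates (forward or backward). -/
def KatoProperty (f : X ≃ₜ X) (c : ℝ) (m : ℕ) : Prop :=
  ∀ C : Set X, Subcontinuum C → c / 2 < diam C →
    ∃ n : ℤ, |n| ≤ (m : ℤ) ∧ c < diam (zIter f n '' C)

/-- The function `ρ(C) = α^{-N(C)}`, where `N(C)` is the least `|n|` with
`diam(fⁿ(C)) > c` (and `ρ(C) = 0` if no such `n` exists, e.g. for singletons). -/
noncomputable def rho (f : X ≃ₜ X) (c α : ℝ) (C : Set X) : ℝ :=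
  sSup {r : ℝ | ∃ n : ℤ, r = α ^ (-|n|) ∧ c < diam (zIter f n '' C)}

/-- The function `P(C_(p,q)) = inf Σ ρ(A_i)` over chains of subcontinua covering `C`
from `p` to `q`. -/
noncomputable def Pfun (f : X ≃ₜ X) (c α : ℝ) (p q : X) (C : Set X) : ℝ :=
  sInf {s : ℝ | ∃ (n : ℕ) (A : ℕ → Set X) (a : ℕ → X),
    1 ≤ n ∧ a 0 = p ∧ a n = q ∧
    (∀ i < n, Subcontinuum (A i) ∧ a i ∈ A i ∧ a (i + 1) ∈ A i) ∧
    C = ⋃ i ∈ Finset.range n, A i ∧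
    s = ∑ i ∈ Finset.range n, rho f c α (A i)}

/-- The function `D'(C_(p,q)) = max_{|i| ≤ n₀ - 1} P(f^i(C_(p,q)))/λ^{|i|}`. -/
noncomputable def Dprime (f : X ≃ₜ X) (c α lam : ℝ) (n₀ : ℕ) (p q : X) (C : Set X) : ℝ :=
  sSup {r : ℝ | ∃ i : ℤ, |i| ≤ (n₀ : ℤ) - 1 ∧
    r = Pfun f c α (zIter f i p) (zIter f i q) (zIter f i '' C) / lam ^ |i|}

theorem continuous_zIter (f : X ≃ₜ X) (i : ℤ) : Continuous (zIter f i) := by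
  unfold zIter
  split_ifs
  · exact f.continuous.iterate _
  · exact f.symm.continuous.iterate _

theorem Subcontinuum.image {C : Set X} (hC : Subcontinuum C) {g : X → X} (hg : Continuous g) :
    Subcontinuum (g '' C) :=
  ⟨hC.1.image hg, hC.2.image g hg.continuousOn⟩

/-- A continuous self-map of a compact metric space sends sets of small diameter to sets of
small diameter. -/
theorem eventually_forall_diam_image_lt [CompactSpace X] {g : X → X} (hg : Continuous g)
    {γ : ℝ} (hγ : 0 < γ) :
    ∀ᶠ η in 𝓝[>] (0 : ℝ), ∀ C : Set X, diam C < η → diam (g '' C) < γ := by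
  obtain ⟨η₀, hη₀, h⟩ := Metric.uniformContinuous_iff.1
    (CompactSpace.uniformContinuous_of_continuous hg) (γ / 2) (half_pos hγ)
  filter_upwards [Ioo_mem_nhdsGT hη₀] with η hη C hC
  refine (diam_le_of_forall_dist_le (half_pos hγ).le ?_).trans_lt (half_lt_self hγ)
  rintro _ ⟨x, hx, rfl⟩ _ ⟨y, hy, rfl⟩
  exact (h ((dist_le_diam_of_mem isBounded_of_compactSpace hx hy).trans_lt
    (hC.trans hη.2))).le

/-- If `D'` is bounded by `1` and small on sets of small diameter, then the weighted values
`D' (fⁱ(C)) / λ^|i|` are small on sets of small diameter, uniformly in `i`. -/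
theorem exists_forall_diam_lt_zIter_div_le [CompactSpace X] (f : X ≃ₜ X) {lam : ℝ}
    (hlam : 1 < lam) {D' : X → X → Set X → ℝ}
    (hbd : ∀ (C : Set X) (p q : X), Subcontinuum C → p ∈ C → q ∈ C → D' p q C ≤ 1)
    (hsmall : ∀ δ : ℝ, 0 < δ → ∃ γ : ℝ, 0 < γ ∧ ∀ (C : Set X) (p q : X),
      Subcontinuum C → p ∈ C → q ∈ C → diam C < γ → D' p q C < δ)
    {ε : ℝ} (hε : 0 < ε) :
    ∃ η : ℝ, 0 < η ∧ ∀ (C : Set X) (p q : X), Subcontinuum C → p ∈ C → q ∈ C → diam C < η →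
      ∀ i : ℤ, D' (zIter f i p) (zIter f i q) (zIter f i '' C) / lam ^ |i| ≤ ε := by
  obtain ⟨γ, hγ, hγD⟩ := hsmall ε hε
  obtain ⟨N, hN⟩ := pow_unbounded_of_one_lt ε⁻¹ hlam
  have hev := (Filter.eventually_all_finite (Set.finite_Icc (-(N : ℤ)) N)).2 fun i _ =>
    eventually_forall_diam_image_lt (continuous_zIter f i) hγ
  obtain ⟨η, hη, hη0⟩ := (hev.and self_mem_nhdsWithin).exists
  refine ⟨η, hη0, fun C p q hC hp hq hdiam i => ?_⟩
  have hiC := hC.image (continuous_zIter f i)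
  have hip := mem_image_of_mem (zIter f i) hp
  have hiq := mem_image_of_mem (zIter f i) hq
  rw [div_le_iff₀ (by positivity)]
  by_cases hi : |i| ≤ N
  · exact (hγD _ _ _ hiC hip hiq (hη i (abs_le.1 hi) C hdiam)).le.trans
      (le_mul_of_one_le_right hε.le (one_le_zpow₀ hlam.le (abs_nonneg i)))
  · have hpow : ε⁻¹ ≤ lam ^ |i| := by
      refine hN.le.trans ?_
      rw [← zpow_natCast]
      exact zpow_le_zpow_right₀ hlam.le (not_le.1 hi).le
    calc _ ≤ (1 : ℝ) := hbd _ _ _ hiC hip hiq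
      _ = ε * ε⁻¹ := (mul_inv_cancel₀ hε.ne').symm
      _ ≤ _ := by gcongr

/-- The supremum construction `D = sup_{i∈ℤ} D'(f^i(·))/λ^{|i|}` over a hyperbolic
cw-metric `D'` bounded by `1` is compatible with `D'` and with the diameter. -/
theorem sup_construction_compatible
    [CompactSpace X]
    (f : X ≃ₜ X) (lam : ℝ) (hlam : 1 < lam)
    (D' D : X → X → Set X → ℝ) (hD' : IsHypCwMetric f D')
    (hbd : ∀ (C : Set X) (p q : X), Subcontinuum C → p ∈ C → q ∈ C → D' p q C ≤ 1)
    (hD : ∀ (p q : X) (C : Set X), D p q C =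
      sSup {r : ℝ | ∃ i : ℤ,
        r = D' (zIter f i p) (zIter f i q) (zIter f i '' C) / lam ^ |i|}) :
    (∀ ε : ℝ, 0 < ε → ∃ ξ : ℝ, 0 < ξ ∧
      ∀ (C : Set X) (p q : X), Subcontinuum C → p ∈ C → q ∈ C →
        D' p q C ≤ ξ → D p q C ≤ ε) ∧
    (∀ δ : ℝ, 0 < δ → ∃ γ : ℝ, 0 < γ ∧
      (∀ (C : Set X) (p q : X), Subcontinuum C → p ∈ C → q ∈ C →
        diam C < γ → D p q C < δ) ∧
      (∀ (C : Set X) (p q : X), Subcontinuum C → p ∈ C → q ∈ C →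
        D p q C < γ → diam C < δ)) := by
  have hsmall : ∀ ε : ℝ, 0 < ε → ∃ η : ℝ, 0 < η ∧ ∀ (C : Set X) (p q : X),
      Subcontinuum C → p ∈ C → q ∈ C → diam C < η → D p q C ≤ ε := by
    intro ε hε
    obtain ⟨η, hη, h⟩ := exists_forall_diam_lt_zIter_div_le f hlam hbd
      (fun δ hδ => (hD'.compat δ hδ).imp fun _ hγ => ⟨hγ.1, hγ.2.1⟩) hε
    refine ⟨η, hη, fun C p q hC hp hq hdiam => ?_⟩
    rw [hD]
    refine csSup_le ⟨_, 0, rfl⟩ ?_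
    rintro _ ⟨i, rfl⟩
    exact h C p q hC hp hq hdiam i
  have hle : ∀ (C : Set X) (p q : X), Subcontinuum C → p ∈ C → q ∈ C → D' p q C ≤ D p q C := by
    intro C p q hC hp hq
    rw [hD]
    refine le_csSup ⟨1, ?_⟩ ⟨0, by simp [zIter]⟩
    rintro _ ⟨i, rfl⟩
    rw [div_le_one (by positivity)]
    exact (hbd _ _ _ (hC.image (continuous_zIter f i)) (mem_image_of_mem _ hp)
      (mem_image_of_mem _ hq)).trans (one_le_zpow₀ hlam.le (abs_nonneg i))
  constructor
  · intro ε hε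
    obtain ⟨η, hη, h⟩ := hsmall ε hε
    obtain ⟨γ, hγ, -, hdiam⟩ := hD'.compat η hη
    exact ⟨γ / 2, half_pos hγ, fun C p q hC hp hq hle' =>
      h C p q hC hp hq (hdiam C p q hC hp hq (hle'.trans_lt (half_lt_self hγ)))⟩
  · intro δ hδ
    obtain ⟨η, hη, h⟩ := hsmall (δ / 2) (half_pos hδ)
    obtain ⟨γ, hγ, -, hdiam⟩ := hD'.compat δ hδ
    refine ⟨min η γ, lt_min hη hγ, fun C p q hC hp hq hlt => ?_, fun C p q hC hp hq hlt => ?_⟩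
    · exact (h C p q hC hp hq (hlt.trans_le (min_le_left _ _))).trans_lt (half_lt_self hδ)
    · exact hdiam C p q hC hp hq
        ((hle C p q hC hp hq).trans_lt (hlt.trans_le (min_le_right _ _)))

end CwDyn
end

section
/- Let f be a homeomorphism of a compact metric space X whose chain-recurrent set decomposes into finitely many chain-recurrent classes C_1,…,C_k, and suppose X = ⋃_{i=1}^k W^s(C_i) = ⋃_{i=1}^k W^u(C_i). Then there exists i with W^u(C_i)=C_i (an attractor) and there exists j with W^s(C_j)=C_j (a repeller). -/
open Metric Set Filter Topology

namespace CwDyn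

variable {X : Type*} [MetricSpace X]

/-- One step of an ε-pseudo-orbit. -/
def PseudoStep (g : X → X) (ε : ℝ) (x y : X) : Prop := dist (g x) y ≤ ε

theorem pseudoOrbit_iff_transGen {g : X → X} {ε : ℝ} {x y : X} :
    PseudoOrbit g ε x y ↔ Relation.TransGen (PseudoStep g ε) x y := by
  constructor
  · rintro ⟨m, σ, hm, rfl, rfl, hσ⟩
    induction m, hm using Nat.le_induction with
    | base => exact .single (hσ 0 one_pos)
    | succ m hm ih => exact (ih fun k hk => hσ k (by omega)).tail (hσ m (by omega))
  · intro h
    induction h with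
    | single h =>
      rename_i b
      refine ⟨1, fun n => if n = 0 then x else b, le_rfl, by simp, by simp, fun k hk => ?_⟩
      obtain rfl : k = 0 := by omega
      simpa [PseudoStep] using h
    | tail _ h ih =>
      rename_i b c _
      obtain ⟨m, σ, hm, h0, hb, hσ⟩ := ih
      refine ⟨m + 1, fun n => if n ≤ m then σ n else c, by omega, by simpa using h0, by simp,
        fun k hk => ?_⟩
      rcases (show k < m ∨ k = m by omega) with hk | rfl
      · simpa [hk.le, Nat.succ_le_of_lt hk] using hσ k hk
      · simpa [PseudoStep, hb] using h

/-- `y` is reachable from `x` by ε-pseudo-orbits for every positive ε. -/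
def ChainTo (g : X → X) (x y : X) : Prop :=
  ∀ ε : ℝ, 0 < ε → Relation.TransGen (PseudoStep g ε) x y

theorem ChainTo.trans {g : X → X} {x y z : X} (hxy : ChainTo g x y) (hyz : ChainTo g y z) :
    ChainTo g x z :=
  fun ε hε => (hxy ε hε).trans (hyz ε hε)

theorem ChainTo.apply (g : X → X) (x : X) : ChainTo g x (g x) :=
  fun ε hε => .single (by simpa [PseudoStep] using hε.le)

theorem chainRecurrent_iff_chainTo {g : X → X} {x : X} : ChainRecurrent g x ↔ ChainTo g x x :=
  forall₂_congr fun _ _ => pseudoOrbit_iff_transGen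

theorem mem_chainClass_iff {g : X → X} {x y : X} :
    y ∈ ChainClass g x ↔ ChainTo g x y ∧ ChainTo g y x := by
  simp only [ChainClass, mem_ofPred_eq, pseudoOrbit_iff_transGen, chainRecurrent_iff_chainTo]
  exact ⟨fun h => ⟨fun ε hε => (h.2 ε hε).1, fun ε hε => (h.2 ε hε).2⟩,
    fun h => ⟨h.2.trans h.1, fun ε hε => ⟨h.1 ε hε, h.2 ε hε⟩⟩⟩

theorem ChainTo.apply_left {g : X → X} (hg : UniformContinuous g) {x : X} (hx : ChainTo g x x) :
    ChainTo g (g x) x := by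
  intro ε hε
  obtain ⟨δ, hδ, hgδ⟩ := Metric.uniformContinuous_iff.1 hg (ε / 2) (half_pos hε)
  set η := min (δ / 2) (ε / 2)
  have hη : 0 < η := lt_min (half_pos hδ) (half_pos hε)
  obtain ⟨w, hxw, hwx⟩ := Relation.TransGen.head'_iff.1 (hx η hη)
  obtain ⟨v, hwv, hvx⟩ := Relation.TransGen.head'_iff.1 (Relation.TransGen.trans_right hwx (hx η hη))
  have hstep : PseudoStep g ε (g x) v := by
    have h₁ : dist (g (g x)) (g w) < ε / 2 :=
      hgδ (hxw.trans_lt ((min_le_left _ _).trans_lt (half_lt_self hδ)))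
    have h₂ : dist (g w) v ≤ ε / 2 := le_trans hwv (min_le_right _ _)
    exact (dist_triangle _ (g w) _).trans (by linarith)
  exact .head' hstep (Relation.ReflTransGen.mono (fun _ _ hab =>
    le_trans hab ((min_le_right _ _).trans (half_le_self hε.le))) _ _ hvx)

theorem ChainTo.symm_apply [CompactSpace X] {f : X ≃ₜ X} {x y : X} (h : ChainTo f x y) :
    ChainTo f (f.symm x) (f.symm y) := by
  intro ε hε
  obtain ⟨δ, hδ, hfδ⟩ := Metric.uniformContinuous_iff.1
    (CompactSpace.uniformContinuous_of_continuous f.symm.continuous) ε hε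
  refine (h (δ / 2) (half_pos hδ)).lift f.symm fun a b hab => ?_
  have := hfδ (lt_of_le_of_lt hab (half_lt_self hδ))
  simpa [PseudoStep, Function.onFun] using this.le

theorem apply_mem_chainClass [CompactSpace X] {f : X ≃ₜ X} {p x : X} (hx : x ∈ ChainClass f p) :
    f x ∈ ChainClass f p := by
  rw [mem_chainClass_iff] at hx ⊢
  exact ⟨hx.1.trans (.apply f x), (ChainTo.apply_left
    (CompactSpace.uniformContinuous_of_continuous f.continuous) (hx.2.trans hx.1)).trans hx.2⟩

theorem symm_apply_mem_chainClass [CompactSpace X] {f : X ≃ₜ X} {p x : X}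
    (hx : x ∈ ChainClass f p) : f.symm x ∈ ChainClass f p := by
  rw [mem_chainClass_iff] at hx ⊢
  have h₁ : ChainTo f x (f.symm x) := by
    simpa using ChainTo.apply_left (CompactSpace.uniformContinuous_of_continuous f.continuous)
      (hx.2.trans hx.1).symm_apply
  have h₂ : ChainTo f (f.symm x) x := by simpa using ChainTo.apply f (f.symm x)
  exact ⟨hx.1.trans h₁, h₂.trans hx.2⟩

theorem subset_wstab_of_mapsTo {g : X → X} {C : Set X} (h : MapsTo g C C) : C ⊆ Wstab g C :=
  fun x hx => by simp [Wstab, infDist_zero_of_mem (h.iterate _ hx)]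

theorem chainTo_of_mem_wstab {g : X → X} {p x : X} (hp : p ∈ ChainClass g p)
    (hx : x ∈ Wstab g (ChainClass g p)) : ChainTo g x p := by
  intro ε hε
  obtain ⟨N, hN⟩ := (hx.eventually (gt_mem_nhds hε)).exists_forall_of_atTop
  obtain ⟨y, hy, hdist⟩ := (infDist_lt_iff ⟨p, hp⟩).1 (hN (N + 1) N.le_succ)
  rw [Function.iterate_succ_apply'] at hdist
  have hiter : ∀ n : ℕ, Relation.ReflTransGen (PseudoStep g ε) x (g^[n] x) := by
    intro n
    induction n with
    | zero => exact .refl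
    | succ n ih =>
      rw [Function.iterate_succ_apply']
      exact ih.tail (by simpa [PseudoStep] using hε.le)
  exact (Relation.TransGen.tail' (hiter N) hdist.le).trans ((mem_chainClass_iff.1 hy).2 ε hε)

theorem chainTo_of_mem_wunstab [CompactSpace X] {f : X ≃ₜ X} {p x : X}
    (hp : p ∈ ChainClass f p) (hx : x ∈ Wunstab f (ChainClass f p)) : ChainTo f p x := by
  intro ε hε
  obtain ⟨δ, hδ, hfδ⟩ := Metric.uniformContinuous_iff.1
    (CompactSpace.uniformContinuous_of_continuous f.continuous) ε hε
  obtain ⟨N, hN⟩ := (hx.eventually (gt_mem_nhds hδ)).exists_forall_of_atTop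
  obtain ⟨y, hy, hdist⟩ := (infDist_lt_iff ⟨p, hp⟩).1 (hN (N + 1) N.le_succ)
  have hstep : PseudoStep f ε y (f.symm^[N] x) := by
    have := hfδ hdist
    rw [Function.iterate_succ_apply', f.apply_symm_apply, dist_comm] at this
    exact this.le
  have hiter : ∀ n : ℕ, Relation.ReflTransGen (PseudoStep f ε) (f.symm^[n] x) x := by
    intro n
    induction n with
    | zero => exact .refl
    | succ n ih =>
      rw [Function.iterate_succ_apply']
      exact ih.head (by simpa [PseudoStep] using hε.le)
  exact ((mem_chainClass_iff.1 hy).1 ε hε).trans (.head' hstep (hiter N))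

theorem exists_forall_rel_symm_of_finite {α : Type*} [Finite α] [Nonempty α] (r : α → α → Prop)
    (hr : ∀ a b c, r a b → r b c → r a c) : ∃ m, ∀ a, r m a → r a m := by
  have : IsTrans α fun a b => r b a ∧ ¬ r a b :=
    ⟨fun a b c hab hbc => ⟨hr _ _ _ hbc.1 hab.1, fun hac => hab.2 (hr _ _ _ hac hbc.1)⟩⟩
  have : Std.Irrefl fun a b => r b a ∧ ¬ r a b := ⟨fun a h => h.2 h.1⟩
  obtain ⟨m, -, hm⟩ := (Finite.wellFounded_of_trans_of_irrefl
    fun a b => r b a ∧ ¬ r a b).has_min univ univ_nonempty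
  exact ⟨m, fun a hma => by_contra fun h => hm a (mem_univ a) ⟨hma, h⟩⟩

/-- If the chain-recurrent set of a homeomorphism decomposes into finitely many
chain-recurrent classes whose stable sets and unstable sets each cover `X`, then some
class is an attractor and some class is a repeller. -/
theorem exists_attractor_and_repeller
    [CompactSpace X]
    (f : X ≃ₜ X) (k : ℕ) (hk : 1 ≤ k) (Cl : Fin k → Set X)
    (hclass : ∀ i : Fin k, IsChainClass (⇑f) (Cl i))
    (hdecomp : {x : X | ChainRecurrent (⇑f) x} = ⋃ i : Fin k, Cl i)
    (hcovS : (⋃ i : Fin k, Wstab (⇑f) (Cl i)) = Set.univ)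
    (hcovU : (⋃ i : Fin k, Wunstab f (Cl i)) = Set.univ) :
    (∃ i : Fin k, Wunstab f (Cl i) = Cl i) ∧ (∃ j : Fin k, Wstab (⇑f) (Cl j) = Cl j) := by
  choose p hp hC using hclass
  obtain rfl : Cl = fun i => ChainClass f (p i) := funext hC
  have hmem : ∀ i, p i ∈ ChainClass f (p i) := fun i =>
    mem_chainClass_iff.2 ⟨chainRecurrent_iff_chainTo.1 (hp i), chainRecurrent_iff_chainTo.1 (hp i)⟩
  have hS : ∀ x, ∃ j, x ∈ Wstab f (ChainClass f (p j)) := fun x => by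
    simpa using hcovS.ge (mem_univ x)
  have hU : ∀ x, ∃ j, x ∈ Wunstab f (ChainClass f (p j)) := fun x => by
    simpa using hcovU.ge (mem_univ x)
  have : Nonempty (Fin k) := ⟨⟨0, hk⟩⟩
  constructor
  · obtain ⟨i, hi⟩ := exists_forall_rel_symm_of_finite (fun i j => ChainTo f (p i) (p j))
      fun _ _ _ => ChainTo.trans
    refine ⟨i, Subset.antisymm (fun x hx => ?_)
      (subset_wstab_of_mapsTo (g := f.symm) fun _ => symm_apply_mem_chainClass)⟩
    obtain ⟨j, hj⟩ := hS x
    have hix := chainTo_of_mem_wunstab (hmem i) hx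
    have hxj := chainTo_of_mem_wstab (hmem j) hj
    exact mem_chainClass_iff.2 ⟨hix, hxj.trans (hi j (hix.trans hxj))⟩
  · obtain ⟨j, hj⟩ := exists_forall_rel_symm_of_finite (fun i j => ChainTo f (p j) (p i))
      fun _ _ _ hab hbc => hbc.trans hab
    refine ⟨j, Subset.antisymm (fun x hx => ?_)
      (subset_wstab_of_mapsTo fun _ => apply_mem_chainClass)⟩
    obtain ⟨i, hi⟩ := hU x
    have hxj := chainTo_of_mem_wstab (hmem j) hx
    have hix := chainTo_of_mem_wunstab (hmem i) hi
    exact mem_chainClass_iff.2 ⟨(hj i (hix.trans hxj)).trans hix, hxj⟩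

end CwDyn
end
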